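/- Let ω⁽¹⁾, ω⁽²⁾ be smooth zero-mean functions on S¹ with associated velocities u⁽ⁱ⁾ defined by u⁽ⁱ⁾_x = H(ω⁽ⁱ⁾) and u⁽ⁱ⁾ zero-mean, and set ω̃ = ω⁽¹⁾ − ω⁽²⁾, ũ = u⁽¹⁾ − u⁽²⁾. Then ⟨ũ_x ω⁽¹⁾ + u⁽²⁾_x ω̃ + 2ũ ω⁽¹⁾_x + 2u⁽²⁾ ω̃_x, ω̃⟩_{L²} ≤ ‖ω̃‖²_{L²}(‖ω⁽¹⁾‖_{L²} + ‖ω⁽²⁾‖_{L²} + 2‖ω⁽¹⁾‖_{Ḣ¹}) + 2‖ω̃‖_{Ḣ¹}‖ω⁽²⁾‖_{L²}‖ω̃‖_{L²}. -/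

import Mathlib

/-- Orthonormal basis of zero-mean `L²(S¹)`. -/
noncomputable def ebasis (k : ℤ) (x : ℝ) : ℝ :=
  if 1 ≤ k then Real.cos ((k : ℝ) * x) / Real.sqrt Real.pi
  else Real.sin (-(k : ℝ) * x) / Real.sqrt Real.pi

/-- Fourier coefficient `⟨f, e_k⟩`. -/
noncomputable def fc (f : ℝ → ℝ) (k : ℤ) : ℝ :=
  ∫ x in (0 : ℝ)..(2 * Real.pi), f x * ebasis k x

/-- Homogeneous Sobolev norm `‖f‖_{Ḣ^s}`. -/
noncomputable def sobNorm (s : ℝ) (f : ℝ → ℝ) : ℝ :=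
  Real.sqrt (∑' k : ℤ, (|k| : ℝ) ^ (2 * s) * (fc f k) ^ 2)

/-- `L²(S¹)` inner product. -/
noncomputable def l2ip (f g : ℝ → ℝ) : ℝ :=
  ∫ x in (0 : ℝ)..(2 * Real.pi), f x * g x

/-- `L²(S¹)` norm. -/
noncomputable def l2norm (f : ℝ → ℝ) : ℝ := Real.sqrt (l2ip f f)

/-- `g = H(ω)` on Fourier modes. -/
def IsHilbertPair (ω g : ℝ → ℝ) : Prop :=
  ∀ k : ℤ, 1 ≤ k → fc g k = - fc ω (-k) ∧ fc g (-k) = fc ω k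

open MeasureTheory

lemma l2ip_self_nonneg (f : ℝ → ℝ) : 0 ≤ l2ip f f := by
  unfold l2ip
  exact intervalIntegral.integral_nonneg (by positivity) (fun x _ => mul_self_nonneg _)

lemma l2norm_nonneg (f : ℝ → ℝ) : 0 ≤ l2norm f := Real.sqrt_nonneg _

lemma l2norm_sq (f : ℝ → ℝ) : l2norm f ^ 2 = l2ip f f := Real.sq_sqrt (l2ip_self_nonneg f)

lemma l2_cs (f g : ℝ → ℝ) (hf : Continuous f) (hg : Continuous g) :
    |l2ip f g| ≤ l2norm f * l2norm g := by
  have key : ∀ t : ℝ, 0 ≤ l2ip f f * (t * t) + (2 * l2ip f g) * t + l2ip g g := by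
    intro t
    have h : l2ip f f * (t * t) + (2 * l2ip f g) * t + l2ip g g
        = ∫ x in (0 : ℝ)..(2 * Real.pi), (t * f x + g x) ^ 2 := by
      unfold l2ip
      have e : ∀ x, (t * f x + g x) ^ 2
          = (t * t) * (f x * f x) + (2 * t) * (f x * g x) + g x * g x := by
        intro x; ring
      simp_rw [e]
      rw [intervalIntegral.integral_add, intervalIntegral.integral_add, intervalIntegral.integral_const_mul, intervalIntegral.integral_const_mul]
      · ring
      all_goals exact Continuous.intervalIntegrable (by fun_prop) _ _
    rw [h]
    exact intervalIntegral.integral_nonneg (by positivity) (fun x _ => sq_nonneg _)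
  have hd := discrim_le_zero key
  unfold discrim at hd
  refine abs_le_of_sq_le_sq ?_ (mul_nonneg (l2norm_nonneg f) (l2norm_nonneg g))
  rw [mul_pow, l2norm_sq, l2norm_sq]
  linarith

lemma l2_weight (g h : ℝ → ℝ) (M : ℝ) (hg : Continuous g) (hh : Continuous h) (hM : 0 ≤ M)
    (hb : ∀ x ∈ Set.Icc 0 (2 * Real.pi), |h x| ≤ M) :
    l2norm (fun x => h x * g x) ≤ M * l2norm g := by
  refine (sq_le_sq₀ (l2norm_nonneg _) (mul_nonneg hM (l2norm_nonneg g))).mp ?_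
  rw [mul_pow, l2norm_sq, l2norm_sq]
  unfold l2ip
  rw [← intervalIntegral.integral_const_mul]
  apply intervalIntegral.integral_mono_on (by positivity)
  · exact Continuous.intervalIntegrable (by fun_prop) _ _
  · exact Continuous.intervalIntegrable (by fun_prop) _ _
  · intro x hx
    have h1 := hb x hx
    have h2 : h x ^ 2 ≤ M ^ 2 := by
      rw [← sq_abs]; gcongr
    nlinarith [mul_le_mul_of_nonneg_right h2 (sq_nonneg (g x))]

lemma l2_shift (f : ℝ → ℝ) (hp : Function.Periodic f (2 * Real.pi)) (x : ℝ) :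
    ∫ t in (0 : ℝ)..(2 * Real.pi), f (x + t) = ∫ t in (0 : ℝ)..(2 * Real.pi), f t := by
  rw [intervalIntegral.integral_comp_add_left]
  have := hp.intervalIntegral_add_eq x 0
  simpa using this

lemma l2norm_shift (f : ℝ → ℝ) (hp : Function.Periodic f (2 * Real.pi)) (x : ℝ) :
    l2norm (fun t => f (x + t)) = l2norm f := by
  unfold l2norm l2ip
  rw [l2_shift (fun t => f t * f t) (fun t => by simp only [hp t]) x]

lemma kernel (F F' : ℝ → ℝ) (hF : ∀ x, HasDerivAt F (F' x) x) (hc : Continuous F')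
    (hp : Function.Periodic F (2 * Real.pi)) (x : ℝ) :
    l2ip (fun t => t - Real.pi) (fun t => F' (x + t))
      = 2 * Real.pi * F x - ∫ t in (0 : ℝ)..(2 * Real.pi), F t := by
  unfold l2ip
  rw [intervalIntegral.integral_mul_deriv_eq_deriv_mul (u := fun t => t - Real.pi) (u' := fun _ => 1)
    (v := fun t => F (x + t))]
  · simp only [one_mul, l2_shift F hp x, hp x]
    simp
    ring
  · intro t _
    exact (hasDerivAt_id t).sub_const _
  · intro t _
    exact (hF (x + t)).comp_const_add x t
  · exact Continuous.intervalIntegrable (by fun_prop) _ _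
  · exact Continuous.intervalIntegrable (by fun_prop) _ _

lemma deriv_periodic (F : ℝ → ℝ) (T : ℝ) (hp : Function.Periodic F T) :
    Function.Periodic (deriv F) T := by
  intro x
  rw [← deriv_comp_add_const]
  congr 1
  ext y
  exact hp y

lemma sup_bound (v : ℝ → ℝ) (hv : ContDiff ℝ (⊤ : ℕ∞) v)
    (hp : Function.Periodic v (2 * Real.pi))
    (h0 : ∫ x in (0 : ℝ)..(2 * Real.pi), v x = 0) (x : ℝ) :
    |v x| ≤ 3 / 4 * l2norm (deriv v) := by
  have hc : Continuous (deriv v) := hv.continuous_deriv (by simp)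
  have hd : ∀ x, HasDerivAt v (deriv v x) x := fun x =>
    (hv.differentiable (by simp) x).hasDerivAt
  have hk := kernel v (deriv v) hd hc hp x
  rw [h0, sub_zero] at hk
  have hcs := l2_cs (fun t => t - Real.pi) (fun t => deriv v (x + t)) (by fun_prop) (by fun_prop)
  rw [hk, l2norm_shift _ (deriv_periodic v _ hp)] at hcs
  have hK : l2norm (fun t => t - Real.pi) ^ 2 = 2 * Real.pi ^ 3 / 3 := by
    rw [l2norm_sq]
    unfold l2ip
    have : ∀ t : ℝ, (t - Real.pi) * (t - Real.pi) = (t - Real.pi) ^ 2 := fun t => by ring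
    simp_rw [this]
    rw [intervalIntegral.integral_comp_sub_right (fun t => t ^ 2) Real.pi, integral_pow]
    norm_num
    ring
  have hpi := Real.pi_pos
  have hpi' := Real.pi_lt_d2
  have hK' : l2norm (fun t => t - Real.pi) ≤ 3 / 2 * Real.pi := by
    refine (sq_le_sq₀ (l2norm_nonneg _) (by positivity)).mp ?_
    rw [hK]
    nlinarith [sq_nonneg Real.pi, mul_pos hpi hpi]
  rw [abs_mul, abs_of_pos (by positivity : 0 < 2 * Real.pi)] at hcs
  have h3 := mul_le_mul_of_nonneg_right hK' (l2norm_nonneg (deriv v))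
  have h4 : Real.pi * |v x| ≤ Real.pi * (3 / 4 * l2norm (deriv v)) := by nlinarith
  exact le_of_mul_le_mul_left h4 hpi

lemma sup_bound2 (v : ℝ → ℝ) (hv : ContDiff ℝ (⊤ : ℕ∞) v)
    (hp : Function.Periodic v (2 * Real.pi)) (x : ℝ) :
    |v x| ≤ l2norm v + 1 / 2 * l2norm (deriv v) := by
  have hc : Continuous (deriv v) := hv.continuous_deriv (by simp)
  have hc0 : Continuous v := hv.continuous
  have hd : ∀ x, HasDerivAt v (deriv v x) x := fun x =>
    (hv.differentiable (by simp) x).hasDerivAt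
  have hk := kernel (fun x => v x * v x) (fun x => deriv v x * v x + v x * deriv v x)
    (fun x => (hd x).mul (hd x)) (by fun_prop) (fun t => by simp only [hp t]) x
  have e1 : l2ip (fun t => t - Real.pi)
      (fun t => deriv v (x + t) * v (x + t) + v (x + t) * deriv v (x + t))
      = 2 * l2ip (fun t => (t - Real.pi) * v (x + t)) (fun t => deriv v (x + t)) := by
    unfold l2ip
    rw [← intervalIntegral.integral_const_mul]
    congr 1
    ext t
    ring
  have hcs := l2_cs (fun t => (t - Real.pi) * v (x + t)) (fun t => deriv v (x + t))
    (by fun_prop) (by fun_prop)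
  have hw := l2_weight (fun t => v (x + t)) (fun t => t - Real.pi) Real.pi (by fun_prop)
    (by fun_prop) Real.pi_pos.le (fun t ht => by
      rw [abs_le]; constructor <;> linarith [ht.1, ht.2])
  rw [l2norm_shift _ hp] at hw
  rw [l2norm_shift _ (deriv_periodic v _ hp)] at hcs
  have hi : (∫ t in (0 : ℝ)..(2 * Real.pi), v t * v t) = l2norm v ^ 2 := by
    rw [l2norm_sq]; rfl
  rw [e1, hi] at hk
  have ha := l2norm_nonneg v
  have hb := l2norm_nonneg (deriv v)
  have hpi := Real.pi_pos
  have hpi3 := Real.pi_gt_three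
  have h1 := (le_abs_self _).trans (hcs.trans (mul_le_mul_of_nonneg_right hw hb))
  refine abs_le_of_sq_le_sq ?_ (by positivity)
  have h2 : 2 * Real.pi * (v x * v x) ≤
      2 * Real.pi * (l2norm v ^ 2 + l2norm v * l2norm (deriv v)) := by
    nlinarith [sq_nonneg (l2norm v)]
  have h3 := le_of_mul_le_mul_left h2 (by positivity)
  nlinarith [sq_nonneg (l2norm (deriv v))]

lemma fc_zero (f : ℝ → ℝ) : fc f 0 = 0 := by
  simp [fc, ebasis]

lemma fc_pos (f : ℝ → ℝ) (k : ℤ) (hk : 1 ≤ k) :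
    fc f k = (∫ x in (0 : ℝ)..(2 * Real.pi), f x * Real.cos (k * x)) / Real.sqrt Real.pi := by
  unfold fc ebasis
  simp only [hk, if_true]
  rw [← intervalIntegral.integral_div]
  congr 1; ext x; ring

lemma fc_neg (f : ℝ → ℝ) (k : ℤ) (hk : 1 ≤ k) :
    fc f (-k) = (∫ x in (0 : ℝ)..(2 * Real.pi), f x * Real.sin (k * x)) / Real.sqrt Real.pi := by
  unfold fc ebasis
  have : ¬ (1 ≤ -k) := by omega
  simp only [this, if_false]
  rw [← intervalIntegral.integral_div]
  congr 1; ext x; push_cast; rw [neg_neg]; ring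

lemma coeff_eq (f : ℝ → ℝ) (hf : Continuous f) (n : ℤ) :
    ‖fourierCoeffOn Real.two_pi_pos (fun x => (f x : ℂ)) n‖ ^ 2
      = (1 / (2 * Real.pi)) ^ 2 * ((∫ x in (0 : ℝ)..(2 * Real.pi), f x * Real.cos (n * x)) ^ 2
        + (∫ x in (0 : ℝ)..(2 * Real.pi), f x * Real.sin (n * x)) ^ 2) := by
  rw [fourierCoeffOn_eq_integral]
  have e : ∀ x : ℝ, (fourier (-n) (x : AddCircle (2 * Real.pi - 0)) : ℂ) • (f x : ℂ)
      = ((f x * Real.cos (n * x) : ℝ) : ℂ) - ((f x * Real.sin (n * x) : ℝ) : ℂ) * Complex.I := by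
    intro x
    rw [fourier_coe_apply]
    have : 2 * (Real.pi : ℂ) * Complex.I * ((-n : ℤ) : ℂ) * (x : ℂ) / ((2 * Real.pi - 0 : ℝ) : ℂ)
        = (((-(n * x) : ℝ)) : ℂ) * Complex.I := by
      have := Complex.ofReal_ne_zero.mpr Real.pi_ne_zero
      push_cast
      field_simp
      ring
    rw [this, Complex.exp_mul_I, ← Complex.ofReal_cos, ← Complex.ofReal_sin, Real.cos_neg,
      Real.sin_neg]
    simp only [smul_eq_mul]
    push_cast
    ring
  simp_rw [e]
  rw [intervalIntegral.integral_sub, intervalIntegral.integral_mul_const, intervalIntegral.integral_ofReal, intervalIntegral.integral_ofReal, norm_smul, mul_pow]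
  · congr 1
    · rw [sub_zero, Real.norm_eq_abs, sq_abs]
    · rw [← Complex.normSq_eq_norm_sq, Complex.normSq_apply]
      simp
      ring
  · exact Continuous.intervalIntegrable (by fun_prop) _ _
  · exact Continuous.intervalIntegrable (by fun_prop) _ _

lemma coeff_fc (f : ℝ → ℝ) (hf : Continuous f)
    (h0 : ∫ x in (0 : ℝ)..(2 * Real.pi), f x = 0) (n : ℤ) :
    4 * Real.pi * ‖fourierCoeffOn Real.two_pi_pos (fun x => (f x : ℂ)) n‖ ^ 2
      = fc f n ^ 2 + fc f (-n) ^ 2 := by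
  have hpi := Real.pi_pos
  have hs : Real.sqrt Real.pi ^ 2 = Real.pi := Real.sq_sqrt hpi.le
  rw [coeff_eq f hf]
  rcases lt_trichotomy n 0 with h | h | h
  · have h1 := fc_pos f (-n) (by omega)
    have h2 := fc_neg f (-n) (by omega)
    rw [neg_neg] at h2
    rw [h1, h2]
    simp only [div_pow, hs]
    push_cast
    simp only [neg_mul, Real.cos_neg, Real.sin_neg, mul_neg, intervalIntegral.integral_neg]
    field_simp
    ring
  · subst h
    simp [fc_zero, h0]
  · rw [fc_pos f n (by omega), fc_neg f n (by omega)]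
    simp only [div_pow, hs]
    field_simp
    ring

lemma parseval (f : ℝ → ℝ) (hf : Continuous f)
    (h0 : ∫ x in (0 : ℝ)..(2 * Real.pi), f x = 0) :
    HasSum (fun k : ℤ => fc f k ^ 2) (l2ip f f) := by
  have hpi := Real.pi_pos
  have hL : MemLp (fun x => (f x : ℂ)) 2 (volume.restrict (Set.Ioc 0 (2 * Real.pi))) := by
    have hc : Continuous (fun x => (f x : ℂ)) := by fun_prop
    rw [memLp_two_iff_integrable_sq_norm hc.aestronglyMeasurable]
    have hc2 : Continuous (fun x => ‖(f x : ℂ)‖ ^ 2) := by fun_prop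
    exact (hc2.integrableOn_Icc (a := 0) (b := 2 * Real.pi)).mono_set Set.Ioc_subset_Icc_self
  have H := (hasSum_sq_fourierCoeffOn Real.two_pi_pos hL).mul_left (4 * Real.pi)
  simp_rw [coeff_fc f hf h0] at H
  have e : 4 * Real.pi * ((2 * Real.pi - 0)⁻¹ • ∫ x in (0 : ℝ)..(2 * Real.pi), ‖(f x : ℂ)‖ ^ 2)
      = 2 * l2ip f f := by
    have : ∀ x, ‖(f x : ℂ)‖ ^ 2 = f x * f x := fun x => by
      rw [Complex.norm_real, Real.norm_eq_abs, sq_abs, sq]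
    simp_rw [this]
    unfold l2ip
    rw [smul_eq_mul, sub_zero]
    field_simp
    ring
  rw [e] at H
  have hsum : Summable (fun k : ℤ => fc f k ^ 2) :=
    Summable.of_nonneg_of_le (fun k => sq_nonneg _)
      (fun k => le_add_of_nonneg_right (sq_nonneg _)) H.summable
  have hs2 : HasSum (fun k : ℤ => fc f (-k) ^ 2) (∑' k : ℤ, fc f k ^ 2) :=
    (Equiv.neg ℤ).hasSum_iff.mpr hsum.hasSum
  have h3 := H.unique (hsum.hasSum.add hs2)
  have h4 : l2ip f f = ∑' k : ℤ, fc f k ^ 2 := by linarith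
  rw [h4]
  exact hsum.hasSum

lemma deriv_mean (f : ℝ → ℝ) (hf : ContDiff ℝ (⊤ : ℕ∞) f)
    (hp : Function.Periodic f (2 * Real.pi)) :
    ∫ x in (0 : ℝ)..(2 * Real.pi), deriv f x = 0 := by
  have hc : Continuous (deriv f) := hf.continuous_deriv (by simp)
  rw [intervalIntegral.integral_deriv_eq_sub (fun x _ => hf.differentiable (by simp) x) (hc.intervalIntegrable _ _)]
  have := hp 0
  rw [zero_add] at this
  rw [this, sub_self]

/-- If squared Fourier coefficients agree up to reflection, then the norms agree. -/
lemma norm_eq_of_fc (f g : ℝ → ℝ) (hf : Continuous f) (hg : Continuous g)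
    (hf0 : ∫ x in (0 : ℝ)..(2 * Real.pi), f x = 0)
    (hg0 : ∫ x in (0 : ℝ)..(2 * Real.pi), g x = 0)
    (h : ∀ k : ℤ, 1 ≤ k → fc g k = - fc f (-k) ∧ fc g (-k) = fc f k) :
    l2norm g = l2norm f := by
  have h1 := parseval f hf hf0
  have h2 := parseval g hg hg0
  have h3 : HasSum (fun k : ℤ => fc f (-k) ^ 2) (l2ip f f) := (Equiv.neg ℤ).hasSum_iff.mpr h1
  have e : (fun k : ℤ => fc g k ^ 2) = fun k : ℤ => fc f (-k) ^ 2 := by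
    ext n
    rcases lt_trichotomy n 0 with hn | hn | hn
    · have := (h (-n) (by omega)).2
      rw [neg_neg] at this
      rw [this]
    · subst hn; simp [fc_zero]
    · rw [(h n (by omega)).1, neg_sq]
  rw [e] at h2
  unfold l2norm
  rw [h2.unique h3]

lemma sobNorm_eq (f : ℝ → ℝ) (hf : ContDiff ℝ (⊤ : ℕ∞) f)
    (hp : Function.Periodic f (2 * Real.pi)) : sobNorm 1 f = l2norm (deriv f) := by
  have hc : Continuous (deriv f) := hf.continuous_deriv (by simp)
  have hd : ∀ x, HasDerivAt f (deriv f x) x := fun x =>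
    (hf.differentiable (by simp) x).hasDerivAt
  have hp0 : f (2 * Real.pi) = f 0 := by simpa using hp 0
  have A : ∀ k : ℤ, 1 ≤ k → fc (deriv f) k = k * fc f (-k) := by
    intro k hk
    rw [fc_pos _ k hk, fc_neg _ k hk, ← mul_div_assoc]
    congr 1
    have h := intervalIntegral.integral_mul_deriv_eq_deriv_mul (a := 0) (b := 2 * Real.pi)
      (u := fun x => Real.cos (k * x))
      (u' := fun x => -Real.sin (k * x) * k) (v := f) (v' := deriv f)
      (fun x _ => ((Real.hasDerivAt_cos _).comp x (by simpa using (hasDerivAt_id x).const_mul (k : ℝ))))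
      (fun x _ => hd x) (Continuous.intervalIntegrable (by fun_prop) _ _)
      (Continuous.intervalIntegrable (by fun_prop) _ _)
    have hcos : Real.cos (k * (2 * Real.pi)) = 1 := Real.cos_int_mul_two_pi k
    simp only [hcos, hp0, mul_zero, Real.cos_zero, sub_self, zero_sub] at h
    simp_rw [mul_comm (deriv f _)]
    rw [h, ← intervalIntegral.integral_const_mul, ← intervalIntegral.integral_neg]
    congr 1; ext x; ring
  have B : ∀ k : ℤ, 1 ≤ k → fc (deriv f) (-k) = - (k * fc f k) := by
    intro k hk
    rw [fc_neg _ k hk, fc_pos _ k hk, ← mul_div_assoc, ← neg_div]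
    congr 1
    have h := intervalIntegral.integral_mul_deriv_eq_deriv_mul (a := 0) (b := 2 * Real.pi)
      (u := fun x => Real.sin (k * x))
      (u' := fun x => Real.cos (k * x) * k) (v := f) (v' := deriv f)
      (fun x _ => ((Real.hasDerivAt_sin _).comp x (by simpa using (hasDerivAt_id x).const_mul (k : ℝ))))
      (fun x _ => hd x) (Continuous.intervalIntegrable (by fun_prop) _ _)
      (Continuous.intervalIntegrable (by fun_prop) _ _)
    have hsin : Real.sin (k * (2 * Real.pi)) = 0 := by
      have := Real.sin_int_mul_pi (k * 2)
      push_cast at this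
      rwa [mul_assoc] at this
    simp only [hsin, mul_zero, zero_mul, Real.sin_zero, sub_self, zero_sub] at h
    simp_rw [mul_comm (deriv f _)]
    rw [h, ← intervalIntegral.integral_const_mul]
    congr 2; ext x; ring
  have h2 := parseval (deriv f) hc (deriv_mean f hf hp)
  have h3 : HasSum (fun k : ℤ => fc (deriv f) (-k) ^ 2) (l2ip (deriv f) (deriv f)) :=
    (Equiv.neg ℤ).hasSum_iff.mpr h2
  unfold sobNorm l2norm
  rw [← h3.tsum_eq]
  congr 2
  ext n
  have hr : (|n| : ℝ) ^ (2 * (1:ℝ)) = (n : ℝ) ^ 2 := by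
    rw [mul_one, Real.rpow_two, sq_abs]
  rw [hr]
  rcases lt_trichotomy n 0 with hn | hn | hn
  · rw [A (-n) (by omega), neg_neg]; push_cast; ring
  · subst hn; simp [fc_zero]
  · rw [B n (by omega)]; ring

lemma fc_sub (f g : ℝ → ℝ) (hf : Continuous f) (hg : Continuous g) (k : ℤ) :
    fc (fun x => f x - g x) k = fc f k - fc g k := by
  have he : Continuous (ebasis k) := by
    unfold ebasis
    by_cases h : 1 ≤ k
    · simp only [h, if_true]; fun_prop
    · simp only [h, if_false]; fun_prop
  unfold fc
  rw [← intervalIntegral.integral_sub]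
  · congr 1; ext x; ring
  all_goals exact Continuous.intervalIntegrable (by fun_prop) _ _

/-- the difference estimate for two solutions: with
`ω̃ = ω⁽¹⁾ − ω⁽²⁾`, `ũ = u⁽¹⁾ − u⁽²⁾`, `u⁽ⁱ⁾ₓ = H(ω⁽ⁱ⁾)`,
`⟨ũ_x ω⁽¹⁾ + u⁽²⁾_x ω̃ + 2ũ ω⁽¹⁾_x + 2u⁽²⁾ ω̃_x, ω̃⟩ ≤
 ‖ω̃‖²(‖ω⁽¹⁾‖ + ‖ω⁽²⁾‖ + 2‖ω⁽¹⁾‖_{Ḣ¹}) + 2‖ω̃‖_{Ḣ¹}‖ω⁽²⁾‖‖ω̃‖`. -/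
theorem difference_estimate (ω₁ ω₂ u₁ u₂ : ℝ → ℝ)
    (hω₁ : ContDiff ℝ (⊤ : ℕ∞) ω₁) (hω₂ : ContDiff ℝ (⊤ : ℕ∞) ω₂)
    (hu₁ : ContDiff ℝ (⊤ : ℕ∞) u₁) (hu₂ : ContDiff ℝ (⊤ : ℕ∞) u₂)
    (hω₁p : Function.Periodic ω₁ (2 * Real.pi)) (hω₂p : Function.Periodic ω₂ (2 * Real.pi))
    (hu₁p : Function.Periodic u₁ (2 * Real.pi)) (hu₂p : Function.Periodic u₂ (2 * Real.pi))
    (hω₁0 : ∫ x in (0 : ℝ)..(2 * Real.pi), ω₁ x = 0)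
    (hω₂0 : ∫ x in (0 : ℝ)..(2 * Real.pi), ω₂ x = 0)
    (hu₁0 : ∫ x in (0 : ℝ)..(2 * Real.pi), u₁ x = 0)
    (hu₂0 : ∫ x in (0 : ℝ)..(2 * Real.pi), u₂ x = 0)
    (hpair₁ : IsHilbertPair ω₁ (deriv u₁)) (hpair₂ : IsHilbertPair ω₂ (deriv u₂)) :
    l2ip (fun x =>
        (deriv u₁ x - deriv u₂ x) * ω₁ x + deriv u₂ x * (ω₁ x - ω₂ x) +
          2 * (u₁ x - u₂ x) * deriv ω₁ x + 2 * u₂ x * (deriv ω₁ x - deriv ω₂ x))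
      (fun x => ω₁ x - ω₂ x) ≤
    l2norm (fun x => ω₁ x - ω₂ x) ^ 2 *
        (l2norm ω₁ + l2norm ω₂ + 2 * sobNorm 1 ω₁) +
      2 * sobNorm 1 (fun x => ω₁ x - ω₂ x) * l2norm ω₂ *
        l2norm (fun x => ω₁ x - ω₂ x) := by
  have cω₁ := hω₁.continuous
  have cω₂ := hω₂.continuous
  have cu₁ := hu₁.continuous
  have cu₂ := hu₂.continuous
  have dω₁ : Continuous (deriv ω₁) := hω₁.continuous_deriv (by simp)
  have dω₂ : Continuous (deriv ω₂) := hω₂.continuous_deriv (by simp)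
  have du₁ : Continuous (deriv u₁) := hu₁.continuous_deriv (by simp)
  have du₂ : Continuous (deriv u₂) := hu₂.continuous_deriv (by simp)
  have hd : ∀ f : ℝ → ℝ, ContDiff ℝ (⊤ : ℕ∞) f → ∀ x, HasDerivAt f (deriv f x) x :=
    fun f hf x => (hf.differentiable (by simp) x).hasDerivAt
  set w : ℝ → ℝ := fun x => ω₁ x - ω₂ x with hw
  set v : ℝ → ℝ := fun x => u₁ x - u₂ x with hv
  have cw : Continuous w := by fun_prop
  have hvs : ContDiff ℝ (⊤ : ℕ∞) v := hu₁.sub hu₂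
  have hvd : deriv v = fun x => deriv u₁ x - deriv u₂ x := by
    ext x
    exact ((hd u₁ hu₁ x).sub (hd u₂ hu₂ x)).deriv
  have hvp : Function.Periodic v (2 * Real.pi) := fun x => by simp only [hv, hu₁p x, hu₂p x]
  have hv0 : ∫ x in (0 : ℝ)..(2 * Real.pi), v x = 0 := by
    simp only [hv]
    rw [intervalIntegral.integral_sub (cu₁.intervalIntegrable _ _) (cu₂.intervalIntegrable _ _), hu₁0, hu₂0, sub_zero]
  have hw0 : ∫ x in (0 : ℝ)..(2 * Real.pi), w x = 0 := by
    simp only [hw]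
    rw [intervalIntegral.integral_sub (cω₁.intervalIntegrable _ _) (cω₂.intervalIntegrable _ _), hω₁0, hω₂0, sub_zero]
  have dv : Continuous (deriv v) := hvs.continuous_deriv (by simp)
  have cv : Continuous v := hvs.continuous
  have hnorm : l2norm (deriv v) = l2norm w := by
    apply norm_eq_of_fc w (deriv v) cw dv hw0 (deriv_mean v hvs hvp)
    intro k hk
    rw [hvd, fc_sub _ _ du₁ du₂, fc_sub _ _ du₁ du₂, fc_sub _ _ cω₁ cω₂, fc_sub _ _ cω₁ cω₂,
      (hpair₁ k hk).1, (hpair₁ k hk).2, (hpair₂ k hk).1, (hpair₂ k hk).2]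
    constructor <;> ring
  -- the transport terms cancel
  have hcancel : ∫ x in (0 : ℝ)..(2 * Real.pi),
      (deriv u₂ x * (w x * w x) + u₂ x * (2 * w x * (deriv ω₁ x - deriv ω₂ x))) = 0 := by
    have hD : ∀ x, HasDerivAt (fun x => u₂ x * (w x * w x))
        (deriv u₂ x * (w x * w x) + u₂ x * (2 * w x * (deriv ω₁ x - deriv ω₂ x))) x := by
      intro x
      have hwd : HasDerivAt w (deriv ω₁ x - deriv ω₂ x) x := (hd ω₁ hω₁ x).sub (hd ω₂ hω₂ x)
      have hm := (hd u₂ hu₂ x).mul (hwd.mul hwd)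
      have e : deriv u₂ x * (w x * w x) + u₂ x * (2 * w x * (deriv ω₁ x - deriv ω₂ x))
          = deriv u₂ x * (w x * w x) + u₂ x * ((deriv ω₁ x - deriv ω₂ x) * w x
            + w x * (deriv ω₁ x - deriv ω₂ x)) := by ring
      rw [e]
      exact hm
    rw [intervalIntegral.integral_eq_sub_of_hasDerivAt (fun x _ => hD x)
      (Continuous.intervalIntegrable (by fun_prop) _ _)]
    have e1 : u₂ (2 * Real.pi) = u₂ 0 := by simpa using hu₂p 0
    have e2 : ω₁ (2 * Real.pi) = ω₁ 0 := by simpa using hω₁p 0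
    have e3 : ω₂ (2 * Real.pi) = ω₂ 0 := by simpa using hω₂p 0
    simp only [hw, e1, e2, e3, sub_self]
  have hsplit : l2ip (fun x =>
        (deriv u₁ x - deriv u₂ x) * ω₁ x + deriv u₂ x * (ω₁ x - ω₂ x) +
          2 * (u₁ x - u₂ x) * deriv ω₁ x + 2 * u₂ x * (deriv ω₁ x - deriv ω₂ x)) w
      = l2ip (fun x => ω₁ x * deriv v x) w + 2 * l2ip (fun x => v x * deriv ω₁ x) w := by
    rw [← add_zero (l2ip (fun x => ω₁ x * deriv v x) w + _), ← hcancel]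
    unfold l2ip
    rw [← intervalIntegral.integral_const_mul, ← intervalIntegral.integral_add, ← intervalIntegral.integral_add]
    · congr 1
      ext x
      rw [hvd]
      simp only [hw, hv]
      ring
    all_goals exact Continuous.intervalIntegrable (by fun_prop) _ _
  rw [hsplit, sobNorm_eq ω₁ hω₁ hω₁p]
  have nw := l2norm_nonneg w
  have na := l2norm_nonneg ω₁
  have nb := l2norm_nonneg (deriv ω₁)
  have nc := l2norm_nonneg ω₂
  have ns : 0 ≤ sobNorm 1 w := Real.sqrt_nonneg _
  have b1 := l2_weight (deriv v) ω₁ (l2norm ω₁ + 1 / 2 * l2norm (deriv ω₁)) dv cω₁ (by positivity)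
    (fun x _ => sup_bound2 ω₁ hω₁ hω₁p x)
  have b2 := l2_weight (deriv ω₁) v (3 / 4 * l2norm w) dω₁ cv (by positivity)
    (fun x _ => hnorm ▸ sup_bound v hvs hvp hv0 x)
  rw [hnorm] at b1
  have c1 := (le_abs_self _).trans
    ((l2_cs (fun x => ω₁ x * deriv v x) w (by fun_prop) cw).trans (mul_le_mul_of_nonneg_right b1 nw))
  have c2 := (le_abs_self _).trans
    ((l2_cs (fun x => v x * deriv ω₁ x) w (by fun_prop) cw).trans (mul_le_mul_of_nonneg_right b2 nw))
  have p1 : 0 ≤ l2norm w ^ 2 * l2norm ω₂ := by positivity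
  have p2 : 0 ≤ 2 * sobNorm 1 w * l2norm ω₂ * l2norm w := by positivity
  have goal : l2ip (fun x => ω₁ x * deriv v x) w + 2 * l2ip (fun x => v x * deriv ω₁ x) w ≤
      l2norm w ^ 2 * (l2norm ω₁ + 2 * l2norm (deriv ω₁)) :=
    calc _ ≤ _ := add_le_add c1 (mul_le_mul_of_nonneg_left c2 zero_le_two)
      _ = _ := by ring
  linarith
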